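/- arXiv:0706.2963 — 2 statements merged into one kernel-verified Lean document; each statement's English description precedes it below -/
import Mathlib

section
/- (Corollary, achievability.) Let 0 < ε, γ, δ < 1 and let P be a probability mass function on 𝒳. Define 𝒞(γ,P) = sup over measurable Λ ⊆ Θ with μ(Λ) ≥ 1 − γ of inf_{θ∈Λ} I(P, W(·|·,θ)). Then there exists n₀ such that for every n ≥ n₀ and every rate R with 0 ≤ R ≤ 𝒞(γ,P), there exists a length-n code of size M such that μ(Λ_ε) ≥ 1 − γ and n⁻¹ log M ≥ R − 2δ. -/
open scoped BigOperators
open Finset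

section Defs

variable {Θ X Y : Type}

/-- Probability of the output set `B` under the `n`-fold memoryless extension
`Wⁿ(B|x,θ) = ∑_{y∈B} ∏ᵢ W(yᵢ|xᵢ,θ)`. -/
noncomputable def Wn [Fintype Y] (W : Θ → X → Y → ℝ) (n : ℕ) (θ : Θ)
    (x : Fin n → X) (B : Finset (Fin n → Y)) : ℝ :=
  ∑ y ∈ B, ∏ i, W θ (x i) (y i)

/-- Empirical probability mass function `P̂ₓ` of a sequence `x ∈ 𝒳ⁿ`. -/
noncomputable def emp [DecidableEq X] (n : ℕ) (x : Fin n → X) (a : X) : ℝ :=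
  ((Finset.univ.filter fun i => x i = a).card : ℝ) / (n : ℝ)

/-- Empirical conditional pmf `Ŵ_{x,y}` of `y` given `x`. -/
noncomputable def empCond [DecidableEq X] [DecidableEq Y] (n : ℕ)
    (x : Fin n → X) (y : Fin n → Y) (a : X) (b : Y) : ℝ :=
  ((Finset.univ.filter fun i => x i = a ∧ y i = b).card : ℝ) /
    ((Finset.univ.filter fun i => x i = a).card : ℝ)

/-- Kullback–Leibler divergence `D(Q‖P)` (real-valued sum; paired with `absCont`
to encode the `+∞` convention). -/
noncomputable def klDiv [Fintype X] (Q P : X → ℝ) : ℝ :=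
  ∑ a, Q a * Real.log (Q a / P a)

/-- Absolute continuity `Q ≪ P` (finiteness of `D(Q‖P)`). -/
def absCont [Fintype X] (Q P : X → ℝ) : Prop := ∀ a, Q a ≠ 0 → P a ≠ 0

/-- Conditional Kullback–Leibler divergence `D(V‖W|P)` (real-valued sum; paired
with `condAbsCont` to encode the `+∞` convention). -/
noncomputable def condKL [Fintype X] [Fintype Y] (P : X → ℝ) (V W : X → Y → ℝ) : ℝ :=
  ∑ a, P a * ∑ b, V a b * Real.log (V a b / W a b)

/-- Conditional absolute continuity (finiteness of `D(V‖W|P)`). -/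
def condAbsCont (P : X → ℝ) (V W : X → Y → ℝ) : Prop :=
  ∀ a b, P a ≠ 0 → V a b ≠ 0 → W a b ≠ 0

/-- Conditional entropy `H(V|P)`. -/
noncomputable def condEnt [Fintype X] [Fintype Y] (P : X → ℝ) (V : X → Y → ℝ) : ℝ :=
  -∑ a, P a * ∑ b, V a b * Real.log (V a b)

/-- Shannon entropy of a pmf on `Y`. -/
noncomputable def ent [Fintype Y] (Q : Y → ℝ) : ℝ := -∑ b, Q b * Real.log (Q b)

/-- Mutual information `I(P, V)`. -/
noncomputable def mutInfo [Fintype X] [Fintype Y] (P : X → ℝ) (V : X → Y → ℝ) : ℝ :=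
  ∑ a, ∑ b, P a * V a b * Real.log (V a b / ∑ a', P a' * V a' b)

/-- `P` is a probability mass function. -/
def IsPM [Fintype X] (P : X → ℝ) : Prop := (∀ a, 0 ≤ P a) ∧ ∑ a, P a = 1

/-- `V` is a channel from `X` to `Y`. -/
def IsChannel [Fintype Y] (V : X → Y → ℝ) : Prop :=
  (∀ a b, 0 ≤ V a b) ∧ ∀ a, ∑ b, V a b = 1

open scoped Classical in
/-- I-typical input sequences `T_Pⁿ(δ) = {x : D(P̂ₓ‖P) ≤ δ}`. -/
noncomputable def typX [Fintype X] [DecidableEq X] (P : X → ℝ) (n : ℕ) (δ : ℝ) :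
    Finset (Fin n → X) :=
  Finset.univ.filter fun x => absCont (emp n x) P ∧ klDiv (emp n x) P ≤ δ

open scoped Classical in
/-- Conditionally I-typical output sequences `T_Vⁿ(x, δ) = {y : D(Ŵ_{x,y}‖V|P̂ₓ) ≤ δ}`. -/
noncomputable def typY [Fintype X] [Fintype Y] [DecidableEq X] [DecidableEq Y]
    (V : X → Y → ℝ) (n : ℕ) (x : Fin n → X) (δ : ℝ) : Finset (Fin n → Y) :=
  Finset.univ.filter fun y =>
    condAbsCont (emp n x) (empCond n x y) V ∧ condKL (emp n x) (empCond n x y) V ≤ δ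

open scoped Classical in
/-- Robust I-typical set `B_Λⁿ(x, δ) = ⋃_{θ∈Λ} T_{W_θ}ⁿ(x, δ)`. -/
noncomputable def robustTyp [Fintype X] [Fintype Y] [DecidableEq X] [DecidableEq Y]
    (W : Θ → X → Y → ℝ) (n : ℕ) (Λ : Set Θ) (x : Fin n → X) (δ : ℝ) :
    Finset (Fin n → Y) :=
  Finset.univ.filter fun y => ∃ θ ∈ Λ, y ∈ typY (W θ) n x δ

/-- The set `Λ_ε` of channel states at which the maximal error probability of the
code `(c, D)` is at most `ε`. -/
def lambdaSet [Fintype X] [Fintype Y] [DecidableEq X] [DecidableEq Y]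
    (W : Θ → X → Y → ℝ) {n M : ℕ}
    (c : Fin M → Fin n → X) (D : Fin M → Finset (Fin n → Y)) (ε : ℝ) : Set Θ :=
  {θ | ∀ m, Wn W n θ (c m) (D m)ᶜ ≤ ε}

/-- Minimal cardinality `g_Λ(A, η)` of a common `η`-image of `A` via `𝒲_Λ`. -/
noncomputable def gMin [Fintype X] [Fintype Y] (W : Θ → X → Y → ℝ) (n : ℕ)
    (Λ : Set Θ) (A : Finset (Fin n → X)) (η : ℝ) : ℕ :=
  sInf {k : ℕ | ∃ B : Finset (Fin n → Y), B.card = k ∧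
    ∀ x ∈ A, ∀ θ ∈ Λ, η ≤ Wn W n θ x B}

/-- `H(𝒲_Λ|P) = sup_{θ∈Λ} H(W_θ|P)`. -/
noncomputable def entSup [Fintype X] [Fintype Y] (W : Θ → X → Y → ℝ) (Λ : Set Θ)
    (P : X → ℝ) : ℝ :=
  sSup ((fun θ => condEnt P (W θ)) '' Λ)

/-- The set `𝒫_n(𝒴|𝒳)` of empirical conditional pmfs of length-`n` pairs. -/
def empCondSet (X Y : Type) [DecidableEq X] [DecidableEq Y] (n : ℕ) :
    Set (X → Y → ℝ) :=
  {V | ∃ (x : Fin n → X) (y : Fin n → Y), V = fun a b => empCond n x y a b}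

/-- `F` is a relatively τ₀-open subset of `F ∪ Pn`: every `V ∈ F` has a
total-variation neighborhood whose intersection with `Pn` is contained in `F`. -/
def relOpen (F Pn : Set (X → Y → ℝ)) : Prop :=
  ∀ V ∈ F, ∃ r > 0, ∀ V' ∈ Pn, (∀ a b, |V' a b - V a b| < r) → V' ∈ F

/-- A δ-sequence: `δ_n → 0` and `√n · δ_n → ∞`. -/
def IsDeltaSeq (δseq : ℕ → ℝ) : Prop :=
  Filter.Tendsto δseq Filter.atTop (nhds 0) ∧
    Filter.Tendsto (fun n : ℕ => Real.sqrt n * δseq n) Filter.atTop Filter.atTop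

open scoped Classical in
/-- Union over `V ∈ F` of exact conditional type classes `T_Vⁿ(x)`. -/
noncomputable def exactUnion [Fintype X] [Fintype Y] [DecidableEq X] [DecidableEq Y]
    (F : Set (X → Y → ℝ)) (n : ℕ) (x : Fin n → X) : Finset (Fin n → Y) :=
  Finset.univ.filter fun y => ∃ V ∈ F, ∀ a b, empCond n x y a b = V a b

open scoped Classical in
/-- Union over `V ∈ F` of divergence shells `T_Vⁿ(x, ε)`. -/
noncomputable def shellUnion [Fintype X] [Fintype Y] [DecidableEq X] [DecidableEq Y]
    (F : Set (X → Y → ℝ)) (n : ℕ) (x : Fin n → X) (ε : ℝ) : Finset (Fin n → Y) :=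
  Finset.univ.filter fun y => ∃ V ∈ F, y ∈ typY V n x ε

/-- The capacity expression `𝒞(γ, P) = sup_{Λ : μ(Λ) ≥ 1-γ} inf_{θ∈Λ} I(P, W_θ)`. -/
noncomputable def ratesFormula [Fintype X] [Fintype Y] [MeasurableSpace Θ]
    (μ : MeasureTheory.Measure Θ) (W : Θ → X → Y → ℝ) (γ : ℝ) (P : X → ℝ) : ℝ :=
  sSup {r : ℝ | ∃ Λ : Set Θ, MeasurableSet Λ ∧ ENNReal.ofReal (1 - γ) ≤ μ Λ ∧
    r = sInf ((fun θ => mutInfo P (W θ)) '' Λ)}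

/-- A rate `R` is `(ε,γ)`-achievable: for every `δ > 0` and all sufficiently
large `n` there is a length-`n` code of size `M`, with all codewords satisfying
the cost constraint, such that `μ(Λ_ε) ≥ 1-γ` and `n⁻¹ log M ≥ R - δ`. -/
def Achievable [Fintype X] [Fintype Y] [DecidableEq X] [DecidableEq Y] [MeasurableSpace Θ]
    (μ : MeasureTheory.Measure Θ) (W : Θ → X → Y → ℝ) (Γ : X → ℝ)
    (Pbudget γ ε R : ℝ) : Prop :=
  ∀ δ : ℝ, 0 < δ → ∃ N : ℕ, ∀ n : ℕ, N ≤ n →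
    ∃ (M : ℕ) (c : Fin M → Fin n → X) (D : Fin M → Finset (Fin n → Y)),
      0 < M ∧
      (∀ m, ∑ a, Γ a * emp n (c m) a ≤ Pbudget) ∧
      (∀ m m', m ≠ m' → Disjoint (D m) (D m')) ∧
      ENNReal.ofReal (1 - γ) ≤ μ (lambdaSet W c D ε) ∧
      R - δ ≤ (n : ℝ)⁻¹ * Real.log M

end Defs

section SecondMoment

variable {Y : Type*} [Fintype Y]

theorem sum_prod_mul_add_sum_sq (n : ℕ) (p g : Fin n → Y → ℝ) (hp : ∀ i, ∑ b, p i b = 1)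
    (hg : ∀ i, ∑ b, p i b * g i b = 0) (c : ℝ) :
    ∑ y : Fin n → Y, (∏ i, p i (y i)) * (c + ∑ i, g i (y i)) ^ 2 =
      c ^ 2 + ∑ i, ∑ b, p i b * g i b ^ 2 := by
  induction n generalizing c with
  | zero => simp
  | succ n ih =>
    rw [← (Fin.consEquiv fun _ => Y).sum_comp, Fintype.sum_prod_type]
    have key : ∀ b : Y, ∑ y : Fin n → Y,
        (∏ i, p i ((Fin.consEquiv fun _ => Y) (b, y) i)) *
          (c + ∑ i, g i ((Fin.consEquiv fun _ => Y) (b, y) i)) ^ 2 =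
        p 0 b * ((c + g 0 b) ^ 2 + ∑ i : Fin n, ∑ b, p i.succ b * g i.succ b ^ 2) := by
      intro b
      rw [← ih (fun i => p i.succ) (fun i => g i.succ) (fun i => hp _) (fun i => hg _),
        Finset.mul_sum]
      refine Finset.sum_congr rfl fun y _ => ?_
      simp only [Fin.consEquiv_apply, Fin.prod_univ_succ, Fin.sum_univ_succ, Fin.cons_zero,
        Fin.cons_succ]
      ring
    rw [Finset.sum_congr rfl fun b _ => key b, Fin.sum_univ_succ]
    set r := ∑ i : Fin n, ∑ b, p i.succ b * g i.succ b ^ 2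
    have expand : ∀ b, p 0 b * ((c + g 0 b) ^ 2 + r) =
        (c ^ 2 + r) * p 0 b + 2 * c * (p 0 b * g 0 b) + p 0 b * g 0 b ^ 2 := fun b => by ring
    simp only [expand, Finset.sum_add_distrib, ← Finset.mul_sum, hp, hg]
    ring

theorem sum_mul_sub_mean_sq_le {p h : Y → ℝ} (hp0 : ∀ b, 0 ≤ p b) (hp : ∑ b, p b = 1) {B : ℝ}
    (hB : ∀ b, |h b| ≤ B) : ∑ b, p b * (h b - ∑ b', p b' * h b') ^ 2 ≤ B ^ 2 := by
  obtain ⟨m, hm⟩ : ∃ m, m = ∑ b', p b' * h b' := ⟨_, rfl⟩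
  rw [← hm]
  have h1 : ∑ b, p b * (h b - m) ^ 2 = ∑ b, p b * h b ^ 2 - m ^ 2 := by
    have : ∀ b, p b * (h b - m) ^ 2 = p b * h b ^ 2 - 2 * m * (p b * h b) + m ^ 2 * p b :=
      fun b => by ring
    simp only [this, Finset.sum_add_distrib, Finset.sum_sub_distrib, ← Finset.mul_sum, hp, ← hm]
    ring
  have h2 : ∑ b, p b * h b ^ 2 ≤ ∑ b, p b * B ^ 2 :=
    Finset.sum_le_sum fun b _ => mul_le_mul_of_nonneg_left
      (sq_le_sq' (by linarith [neg_abs_le (h b), hB b]) ((le_abs_self _).trans (hB b))) (hp0 b)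
  rw [← Finset.sum_mul, hp, one_mul] at h2
  linarith [sq_nonneg m]

/-- Chebyshev's inequality for a product of probability mass functions. -/
theorem sum_prod_deviation_le (n : ℕ) (p h : Fin n → Y → ℝ) (hp0 : ∀ i b, 0 ≤ p i b)
    (hp : ∀ i, ∑ b, p i b = 1) {B : ℝ} (hB : ∀ i b, |h i b| ≤ B) {s : ℝ} (hs : 0 < s)
    (S : Finset (Fin n → Y))
    (hS : ∀ y ∈ S, s ≤ |∑ i, h i (y i) - ∑ i, ∑ b, p i b * h i b|) :
    ∑ y ∈ S, ∏ i, p i (y i) ≤ n * B ^ 2 / s ^ 2 := by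
  set g : Fin n → Y → ℝ := fun i b => h i b - ∑ b', p i b' * h i b' with hgdef
  have hg : ∀ i, ∑ b, p i b * g i b = 0 := fun i => by
    simp only [hgdef, mul_sub, Finset.sum_sub_distrib, ← Finset.sum_mul, hp, one_mul, sub_self]
  have hvar : ∀ i, ∑ b, p i b * g i b ^ 2 ≤ B ^ 2 := fun i =>
    sum_mul_sub_mean_sq_le (hp0 i) (hp i) (hB i)
  have hnn : ∀ y : Fin n → Y, 0 ≤ ∏ i, p i (y i) := fun y => Finset.prod_nonneg fun i _ => hp0 _ _
  have hle : ∑ y : Fin n → Y, (∏ i, p i (y i)) * (0 + ∑ i, g i (y i)) ^ 2 ≤ n * B ^ 2 := by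
    rw [sum_prod_mul_add_sum_sq n p g hp hg 0, zero_pow two_ne_zero, zero_add]
    simpa using Finset.sum_le_sum fun i (_ : i ∈ Finset.univ) => hvar i
  have hdev : ∀ y ∈ S, s ^ 2 ≤ (0 + ∑ i, g i (y i)) ^ 2 := fun y hy => by
    have h1 := hS y hy
    rw [← Finset.sum_sub_distrib] at h1
    rw [zero_add, ← sq_abs (∑ i, g i (y i))]
    exact pow_le_pow_left₀ hs.le h1 2
  rw [le_div_iff₀ (pow_pos hs 2), Finset.sum_mul]
  refine le_trans (Finset.sum_le_sum fun y hy => mul_le_mul_of_nonneg_left (hdev y hy) (hnn y)) ?_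
  exact le_trans (Finset.sum_le_sum_of_subset_of_nonneg (Finset.subset_univ S) fun y _ _ =>
    mul_nonneg (hnn y) (sq_nonneg _)) hle

theorem sum_prod_eq_one (n : ℕ) (p : Fin n → Y → ℝ) (hp : ∀ i, ∑ b, p i b = 1) :
    ∑ y : Fin n → Y, ∏ i, p i (y i) = 1 := by
  classical
  rw [← Fintype.prod_sum]
  simp [hp]

end SecondMoment

section Expurgation

variable {α : Type*}

theorem exists_mem_le_of_weighted_sum_le (T : Finset α) (w f : α → ℝ) (hw : ∀ x, 0 ≤ w x)
    (hpos : 0 < ∑ x ∈ T, w x) {k : ℝ} (h : ∑ x ∈ T, w x * f x ≤ k * ∑ x ∈ T, w x) :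
    ∃ x ∈ T, f x ≤ k := by
  by_contra! hcon
  obtain ⟨z, hz, hwz⟩ := Finset.exists_lt_of_sum_lt (s := T) (f := fun _ => (0 : ℝ)) (g := w)
    (by simpa using hpos)
  have : ∑ x ∈ T, w x * k < ∑ x ∈ T, w x * f x :=
    Finset.sum_lt_sum (fun x hx => mul_le_mul_of_nonneg_left (hcon x hx).le (hw x))
      ⟨z, hz, mul_lt_mul_of_pos_left (hcon z hz) hwz⟩
  rw [← Finset.sum_mul] at this
  linarith

theorem exists_greedy_sequence (T : Finset α) (w : α → ℝ) (hw : ∀ x, 0 ≤ w x)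
    (hpos : 0 < ∑ x ∈ T, w x) (c : α → α → ℝ) {k : ℝ}
    (hc : ∀ x', ∑ x ∈ T, w x * c x' x ≤ k * ∑ x ∈ T, w x) (N : ℕ) :
    ∃ x : ℕ → α, ∀ j < N, x j ∈ T ∧ ∑ i ∈ Finset.range j, c (x i) (x j) ≤ j * k := by
  have step : ∀ (x : ℕ → α) (j : ℕ), ∃ z ∈ T, ∑ i ∈ Finset.range j, c (x i) z ≤ j * k := by
    intro x j
    refine exists_mem_le_of_weighted_sum_le T w _ hw hpos ?_
    simp only [Finset.mul_sum]
    rw [Finset.sum_comm, ← Finset.mul_sum]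
    calc ∑ i ∈ Finset.range j, ∑ z ∈ T, w z * c (x i) z
        ≤ ∑ i ∈ Finset.range j, k * ∑ x ∈ T, w x := Finset.sum_le_sum fun i _ => hc _
      _ = j * k * ∑ x ∈ T, w x := by simp [mul_assoc]
  induction N with
  | zero =>
    obtain ⟨z, -⟩ : T.Nonempty := by
      by_contra h
      simp [Finset.not_nonempty_iff_eq_empty.1 h] at hpos
    exact ⟨fun _ => z, by simp⟩
  | succ N ih =>
    obtain ⟨x, hx⟩ := ih
    obtain ⟨z, hzT, hz⟩ := step x N
    refine ⟨Function.update x N z, fun j hj => ?_⟩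
    have hupd : ∀ i, i ≠ N → Function.update x N z i = x i := fun i hi =>
      Function.update_of_ne hi _ _
    have hsum : ∀ v, ∀ j ≤ N, ∑ i ∈ Finset.range j, c (Function.update x N z i) v =
        ∑ i ∈ Finset.range j, c (x i) v := fun v j hj =>
      Finset.sum_congr rfl fun i hi => by rw [hupd i (by have := Finset.mem_range.1 hi; omega)]
    rcases Nat.lt_succ_iff_lt_or_eq.1 hj with h | rfl
    · rw [hsum _ _ h.le, hupd j h.ne]
      exact hx j h
    · rw [hsum _ _ le_rfl, Function.update_self]
      exact ⟨hzT, hz⟩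

/-- Selection of `M` points of `T` whose pairwise costs, summed over later points, are small,
when the weighted average of the cost over its second argument is at most `k`. -/
theorem exists_expurgated_family (T : Finset α) (w : α → ℝ) (hw : ∀ x, 0 ≤ w x)
    (hpos : 0 < ∑ x ∈ T, w x) (c : α → α → ℝ) (hc0 : ∀ x x', 0 ≤ c x x') {k : ℝ} (hk : 0 < k)
    (hc : ∀ x', ∑ x ∈ T, w x * c x' x ≤ k * ∑ x ∈ T, w x) {M : ℕ} (hM : 0 < M) :
    ∃ x : Fin M → α, (∀ m, x m ∈ T) ∧
      ∀ m, ∑ m' ∈ Finset.univ.filter (fun m' => m < m'), c (x m) (x m') ≤ 4 * M * k := by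
  obtain ⟨x, hx⟩ := exists_greedy_sequence T w hw hpos c hc (2 * M)
  set cost : ℕ → ℝ := fun i =>
    ∑ j ∈ (Finset.range (2 * M)).filter (fun j => i < j), c (x i) (x j) with hcost
  have hcost0 : ∀ i, 0 ≤ cost i := fun i => Finset.sum_nonneg fun j _ => hc0 _ _
  have htotal : ∑ i ∈ Finset.range (2 * M), cost i ≤ 2 * M * (2 * M * k) := by
    have hswap : ∑ i ∈ Finset.range (2 * M), cost i =
        ∑ j ∈ Finset.range (2 * M), ∑ i ∈ Finset.range j, c (x i) (x j) := by
      refine Finset.sum_comm' fun i j => ?_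
      simp only [Finset.mem_filter, Finset.mem_range]
      omega
    rw [hswap]
    calc ∑ j ∈ Finset.range (2 * M), ∑ i ∈ Finset.range j, c (x i) (x j)
        ≤ ∑ j ∈ Finset.range (2 * M), (2 * M * k : ℝ) := by
          refine Finset.sum_le_sum fun j hj => (hx j (Finset.mem_range.1 hj)).2.trans ?_
          refine mul_le_mul_of_nonneg_right ?_ hk.le
          exact_mod_cast (Finset.mem_range.1 hj).le
      _ = 2 * M * (2 * M * k) := by simp
  set G := (Finset.range (2 * M)).filter (fun i => cost i ≤ 4 * M * k) with hG
  have hcard : M ≤ G.card := by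
    set bad := (Finset.range (2 * M)).filter (fun i => ¬ cost i ≤ 4 * M * k) with hbad
    have hsplit : G.card + bad.card = 2 * M := by
      rw [hG, hbad, Finset.card_filter_add_card_filter_not, Finset.card_range]
    have hb : (bad.card : ℝ) * (4 * M * k) ≤ 2 * M * (2 * M * k) := by
      refine le_trans ?_ htotal
      rw [← nsmul_eq_mul]
      refine (Finset.card_nsmul_le_sum bad cost _ fun i hi => ?_).trans
        (Finset.sum_le_sum_of_subset_of_nonneg (Finset.filter_subset _ _) fun i _ _ => hcost0 i)
      exact (not_le.1 (Finset.mem_filter.1 hi).2).le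
    have hMk : 0 < 4 * M * k := by positivity
    have : (bad.card : ℝ) ≤ M := by
      refine le_of_mul_le_mul_right (hb.trans (le_of_eq ?_)) hMk
      ring
    have : bad.card ≤ M := by exact_mod_cast this
    omega
  set e := G.orderEmbOfCardLe hcard
  have heG : ∀ m, e m ∈ G := fun m => Finset.orderEmbOfCardLe_mem _ _ _
  refine ⟨fun m => x (e m), fun m => ?_, fun m => ?_⟩
  · exact (hx _ (Finset.mem_range.1 (Finset.mem_filter.1 (heG m)).1)).1
  · refine le_trans ?_ (Finset.mem_filter.1 (heG m)).2
    have hmap := Finset.sum_map (Finset.univ.filter (fun m' => m < m')) e.toEmbedding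
      (fun j => c (x (e m)) (x j))
    refine hmap.symm.trans_le ?_
    refine Finset.sum_le_sum_of_subset_of_nonneg ?_ fun j _ _ => hc0 _ _
    intro j hj
    obtain ⟨m', hm', rfl⟩ := Finset.mem_map.1 hj
    refine Finset.mem_filter.2 ⟨(Finset.mem_filter.1 (heG m')).1, ?_⟩
    exact e.strictMono (Finset.mem_filter.1 hm').2

end Expurgation

section Domination

variable {X Y : Type} [Fintype X] [Fintype Y]

/-- The output distribution of the channel `V` under the input distribution `P`. -/
noncomputable def outDist (P : X → ℝ) (V : X → Y → ℝ) (b : Y) : ℝ := ∑ a, P a * V a b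

omit [Fintype Y] in
theorem outDist_pos {P : X → ℝ} (hP : IsPM P) {V : X → Y → ℝ} (hV : ∀ a b, 0 < V a b) (b : Y) :
    0 < outDist P V b := by
  obtain ⟨z, hz, hPz⟩ := Finset.exists_lt_of_sum_lt (s := Finset.univ) (f := fun _ => (0 : ℝ))
    (g := P) (by simp [hP.2])
  exact Finset.sum_pos' (fun a _ => mul_nonneg (hP.1 a) (hV a b).le)
    ⟨z, hz, mul_pos hPz (hV z b)⟩

/-- Replacing the channel inside the logarithm by a dominating one costs at most `η`. -/
theorem mutInfo_sub_le_of_le_exp_mul {P : X → ℝ} (hP : IsPM P) {W V : X → Y → ℝ}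
    (hW : IsChannel W) (hV : IsChannel V) (hVpos : ∀ a b, 0 < V a b) {η : ℝ}
    (hWV : ∀ a b, W a b ≤ Real.exp η * V a b) :
    mutInfo P W - η ≤ ∑ a, P a * ∑ b, W a b * Real.log (V a b / ∑ a', P a' * V a' b) := by
  set QV : Y → ℝ := fun b => ∑ a', P a' * V a' b with hQV
  set QW : Y → ℝ := fun b => ∑ a', P a' * W a' b with hQW
  have hQVpos : ∀ b, 0 < QV b := outDist_pos hP hVpos
  have hQW0 : ∀ b, 0 ≤ QW b := fun b => Finset.sum_nonneg fun a _ => mul_nonneg (hP.1 a) (hW.1 a b)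
  have hterm : ∀ a b, P a * W a b * Real.log (W a b / QW b) ≤
      P a * (W a b * Real.log (V a b / QV b)) + η * (P a * W a b) +
        P a * W a b * (QV b / QW b - 1) := by
    intro a b
    have hPW := mul_nonneg (hP.1 a) (hW.1 a b)
    rcases hPW.eq_or_lt with h0 | hpos
    · rw [← mul_assoc, ← h0]; simp
    · have hWp : 0 < W a b := (pos_of_mul_pos_right hpos (hP.1 a))
      have hQWp : 0 < QW b := hpos.trans_le
        (Finset.single_le_sum (f := fun a => P a * W a b)
          (fun a _ => mul_nonneg (hP.1 a) (hW.1 a b)) (Finset.mem_univ a))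
      have h1 : Real.log (W a b) ≤ η + Real.log (V a b) := by
        have := Real.log_le_log hWp (hWV a b)
        rwa [Real.log_mul (Real.exp_pos _).ne' (hVpos a b).ne', Real.log_exp] at this
      have h2 := Real.log_le_sub_one_of_pos (div_pos (hQVpos b) hQWp)
      rw [Real.log_div (hQVpos b).ne' hQWp.ne'] at h2
      have h3 : Real.log (W a b / QW b) ≤ Real.log (V a b / QV b) + η + (QV b / QW b - 1) := by
        rw [Real.log_div hWp.ne' hQWp.ne', Real.log_div (hVpos a b).ne' (hQVpos b).ne']
        linarith
      calc _ ≤ P a * W a b * (Real.log (V a b / QV b) + η + (QV b / QW b - 1)) :=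
            mul_le_mul_of_nonneg_left h3 hPW
        _ = _ := by ring
  have hmass : ∀ V' : X → Y → ℝ, IsChannel V' → ∑ b, ∑ a, P a * V' a b = 1 := fun V' hV' => by
    rw [Finset.sum_comm]
    simp [← Finset.mul_sum, hV'.2, hP.2]
  have hlast : ∑ b, ∑ a, P a * W a b * (QV b / QW b - 1) ≤ 0 := by
    calc _ ≤ ∑ b, (QV b - QW b) := Finset.sum_le_sum fun b _ => by
          rw [← Finset.sum_mul]
          change QW b * (QV b / QW b - 1) ≤ _
          rcases (hQW0 b).eq_or_lt with h | h
          · rw [← h]; simpa using (hQVpos b).le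
          · field_simp; exact le_rfl
      _ = 0 := by rw [Finset.sum_sub_distrib, hmass V hV, hmass W hW, sub_self]
  have hsum : mutInfo P W ≤ ∑ a, ∑ b, (P a * (W a b * Real.log (V a b / QV b)) +
      η * (P a * W a b) + P a * W a b * (QV b / QW b - 1)) :=
    Finset.sum_le_sum fun a _ => Finset.sum_le_sum fun b _ => hterm a b
  simp only [Finset.sum_add_distrib, ← Finset.mul_sum, hW.2, mul_one, hP.2] at hsum
  rw [Finset.sum_comm (f := fun b a => _)] at hlast
  linarith

/-- Finitely many strictly positive channels dominate all channels up to a factor `exp η`. -/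
theorem exists_finite_dominating_channels (X Y : Type) [Fintype X] [Fintype Y] [Nonempty Y]
    {η : ℝ} (hη : 0 < η) :
    ∃ F : Finset (X → Y → ℝ), (∀ V ∈ F, IsChannel V ∧ ∀ a b, 0 < V a b) ∧
      ∀ W : X → Y → ℝ, IsChannel W → ∃ V ∈ F, ∀ a b, W a b ≤ Real.exp η * V a b := by
  classical
  set K : Set (X → Y → ℝ) := {W | IsChannel W} with hK
  have hclosed : IsClosed K := by
    have : K = (⋂ a, ⋂ b, {W : X → Y → ℝ | 0 ≤ W a b}) ∩ ⋂ a, {W | ∑ b, W a b = 1} := by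
      ext W; simp [hK, IsChannel]
    rw [this]
    refine IsClosed.inter (isClosed_iInter fun a => isClosed_iInter fun b => ?_)
      (isClosed_iInter fun a => ?_)
    · exact isClosed_le continuous_const (by fun_prop)
    · exact isClosed_eq (by fun_prop) continuous_const
  have hcompact : IsCompact K := by
    refine IsCompact.of_isClosed_subset
      (isCompact_univ_pi fun _ : X => isCompact_univ_pi fun _ : Y => isCompact_Icc (a := (0 : ℝ))
        (b := 1)) hclosed fun W hW a _ b _ => ⟨hW.1 a b, ?_⟩
    rw [← hW.2 a]
    exact Finset.single_le_sum (f := W a) (fun b _ => hW.1 a b) (Finset.mem_univ b)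
  let U : {V : X → Y → ℝ // IsChannel V ∧ ∀ a b, 0 < V a b} → Set (X → Y → ℝ) := fun V =>
    ⋂ a, ⋂ b, {W | W a b < Real.exp η * V.1 a b}
  have hU : ∀ V, IsOpen (U V) := fun V =>
    isOpen_iInter_of_finite fun a => isOpen_iInter_of_finite fun b =>
      isOpen_lt (by fun_prop) continuous_const
  have hcover : K ⊆ ⋃ V, U V := by
    intro W hW
    set t := Real.exp (-η) with ht
    have ht1 : t < 1 := Real.exp_lt_one_iff.2 (by linarith)
    have ht0 : 0 < t := Real.exp_pos _
    have hcard : (0 : ℝ) < Fintype.card Y := by exact_mod_cast Fintype.card_pos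
    have hu : 0 < (1 - t) / Fintype.card Y := div_pos (by linarith) hcard
    refine Set.mem_iUnion.2 ⟨⟨fun a b => t * W a b + (1 - t) / Fintype.card Y, ⟨⟨fun a b => ?_,
      fun a => ?_⟩, fun a b => ?_⟩⟩, ?_⟩
    · have := mul_nonneg ht0.le (hW.1 a b); linarith
    · rw [Finset.sum_add_distrib, ← Finset.mul_sum, hW.2 a]
      simp only [Finset.sum_const, Finset.card_univ, nsmul_eq_mul]
      field_simp
      ring
    · have := mul_nonneg ht0.le (hW.1 a b); linarith
    · refine Set.mem_iInter.2 fun a => Set.mem_iInter.2 fun b => ?_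
      have h1 : Real.exp η * t = 1 := by rw [ht, ← Real.exp_add]; simp
      have h2 := mul_pos (Real.exp_pos η) hu
      change W a b < Real.exp η * (t * W a b + (1 - t) / Fintype.card Y)
      rw [mul_add, ← mul_assoc, h1]
      linarith
  obtain ⟨s, hs⟩ := hcompact.elim_finite_subcover U hU hcover
  refine ⟨s.image Subtype.val, fun V hV => ?_, fun W hW => ?_⟩
  · obtain ⟨V', -, rfl⟩ := Finset.mem_image.1 hV
    exact V'.2
  · obtain ⟨V, hVs, hWV⟩ := Set.mem_iUnion₂.1 (hs hW)
    exact ⟨V.1, Finset.mem_image_of_mem _ hVs, fun a b =>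
      (Set.mem_iInter.1 (Set.mem_iInter.1 hWV a) b).le⟩

theorem mutInfo_nonneg {P : X → ℝ} (hP : IsPM P) {W : X → Y → ℝ} (hW : IsChannel W) :
    0 ≤ mutInfo P W := by
  have hterm : ∀ a b, P a * W a b - P a * outDist P W b ≤
      P a * W a b * Real.log (W a b / outDist P W b) := by
    intro a b
    have hmem : ∀ a, 0 ≤ P a * W a b := fun a => mul_nonneg (hP.1 a) (hW.1 a b)
    have hle : P a * W a b ≤ outDist P W b :=
      Finset.single_le_sum (f := fun a => P a * W a b) (fun a _ => hmem a) (Finset.mem_univ a)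
    rcases (hmem a).eq_or_lt with h0 | hpos
    · rw [← h0, zero_mul, zero_sub, neg_nonpos]
      exact mul_nonneg (hP.1 a) ((hmem a).trans hle)
    · have hWp : 0 < W a b := pos_of_mul_pos_right hpos (hP.1 a)
      have hlog := Real.one_sub_inv_le_log_of_pos (div_pos hWp (hpos.trans_le hle))
      refine le_trans (le_of_eq ?_) (mul_le_mul_of_nonneg_left hlog (hmem a))
      field_simp
  have hmass : ∑ b, outDist P W b = 1 := by
    simp only [outDist]
    rw [Finset.sum_comm]
    simp [← Finset.mul_sum, hW.2, hP.2]
  refine le_trans (le_of_eq ?_) (Finset.sum_le_sum fun a _ => Finset.sum_le_sum fun b _ =>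
    hterm a b)
  simp [Finset.sum_sub_distrib, ← Finset.mul_sum, hW.2, hmass]

end Domination

section Coding

variable {X Y : Type} [Fintype X] [Fintype Y]

theorem sum_le_sum_sum_of_forall_exists_mem {α ι : Type*} (S : Finset α) (t : Finset ι)
    (f : ι → Finset α) (w : α → ℝ) (hw : ∀ x, 0 ≤ w x) (h : ∀ x ∈ S, ∃ i ∈ t, x ∈ f i) :
    ∑ x ∈ S, w x ≤ ∑ i ∈ t, ∑ x ∈ f i, w x := by
  classical
  have h1 : ∀ i ∈ t, ∑ x ∈ S, (if x ∈ f i then w x else 0) ≤ ∑ x ∈ f i, w x := fun i _ => by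
    rw [← Finset.sum_filter]
    exact Finset.sum_le_sum_of_subset_of_nonneg (fun x hx => (Finset.mem_filter.1 hx).2)
      fun x _ _ => hw x
  refine le_trans ?_ (Finset.sum_le_sum h1)
  rw [Finset.sum_comm]
  refine Finset.sum_le_sum fun x hx => ?_
  obtain ⟨i, hi, hxi⟩ := h x hx
  refine le_trans (by rw [if_pos hxi]) (Finset.single_le_sum
    (f := fun i => if x ∈ f i then w x else 0) (fun i _ => ?_) hi)
  split_ifs <;> simp [hw]

/-- The information density `∑ᵢ log (V(yᵢ|xᵢ) / (VP)(yᵢ))`. -/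
noncomputable def infoDensity (P : X → ℝ) (V : X → Y → ℝ) {n : ℕ} (x : Fin n → X)
    (y : Fin n → Y) : ℝ :=
  ∑ i, Real.log (V (x i) (y i) / outDist P V (y i))

open scoped Classical in
/-- Outputs whose information density with `x` exceeds `n r` for some channel in `F`. -/
noncomputable def thresholdSet (P : X → ℝ) (F : Finset (X → Y → ℝ)) {n : ℕ} (r : ℝ)
    (x : Fin n → X) : Finset (Fin n → Y) :=
  Finset.univ.filter fun y => ∃ V ∈ F, n * r < infoDensity P V x y

open scoped Classical in
/-- Input sequences whose empirical distribution is uniformly `τ`-close to `P`. -/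
noncomputable def nearType [DecidableEq X] (P : X → ℝ) (n : ℕ) (τ : ℝ) : Finset (Fin n → X) :=
  Finset.univ.filter fun x => ∀ a, |emp n x a - P a| ≤ τ

theorem sum_comp_eq_sum_emp [DecidableEq X] {n : ℕ} (hn : 0 < n) (x : Fin n → X) (φ : X → ℝ) :
    ∑ i, φ (x i) = n * ∑ a, emp n x a * φ a := by
  have hn' : (n : ℝ) ≠ 0 := by positivity
  rw [← Finset.sum_fiberwise Finset.univ x, Finset.mul_sum]
  refine Finset.sum_congr rfl fun a _ => ?_
  rw [Finset.sum_congr rfl fun i hi => by rw [(Finset.mem_filter.1 hi).2], Finset.sum_const,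
    nsmul_eq_mul, emp]
  field_simp

theorem half_le_sum_nearType [DecidableEq X] {P : X → ℝ} (hP : IsPM P) {n : ℕ} (hn : 0 < n)
    {τ : ℝ} (hτ : 0 < τ) (h : 2 * Fintype.card X ≤ n * τ ^ 2) :
    1 / 2 ≤ ∑ x ∈ nearType P n τ, ∏ i, P (x i) := by
  classical
  have hn' : (0 : ℝ) < n := by positivity
  have htotal := Finset.sum_add_sum_compl (nearType P n τ) fun x => ∏ i, P (x i)
  rw [sum_prod_eq_one n (fun _ => P) fun _ => hP.2] at htotal
  have hbad : ∀ a, ∑ x ∈ Finset.univ.filter (fun x : Fin n → X => τ < |emp n x a - P a|),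
      ∏ i, P (x i) ≤ n * 1 ^ 2 / (n * τ) ^ 2 := fun a => by
    refine sum_prod_deviation_le n (fun _ => P) (fun _ b => if b = a then 1 else 0)
      (fun _ => hP.1) (fun _ => hP.2) (fun i b => by split_ifs <;> simp) (mul_pos hn' hτ) _ ?_
    intro x hx
    have h1 := sum_comp_eq_sum_emp hn x (fun b => if b = a then 1 else 0)
    simp only [mul_ite, mul_one, mul_zero, Finset.sum_ite_eq', Finset.mem_univ, if_true] at h1
    simp only [h1, mul_ite, mul_one, mul_zero, Finset.sum_ite_eq', Finset.mem_univ, if_true,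
      Finset.sum_const, Finset.card_univ, Fintype.card_fin, nsmul_eq_mul]
    rw [← mul_sub, abs_mul, abs_of_pos hn']
    exact mul_le_mul_of_nonneg_left (Finset.mem_filter.1 hx).2.le hn'.le
  have hcompl : ∑ x ∈ (nearType P n τ)ᶜ, ∏ i, P (x i) ≤ 1 / 2 := by
    refine (sum_le_sum_sum_of_forall_exists_mem _ Finset.univ
      (fun a => Finset.univ.filter (fun x : Fin n → X => τ < |emp n x a - P a|)) _
      (fun x => Finset.prod_nonneg fun i _ => hP.1 _) fun x hx => ?_).trans
      ((Finset.sum_le_sum fun a _ => hbad a).trans ?_)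
    · simp only [nearType, Finset.mem_compl, Finset.mem_filter, Finset.mem_univ, true_and,
        not_forall, not_le] at hx
      obtain ⟨a, ha⟩ := hx
      exact ⟨a, Finset.mem_univ a, by simpa using ha⟩
    · rw [Finset.sum_const, Finset.card_univ, nsmul_eq_mul]
      have : (n : ℝ) * 1 ^ 2 / (n * τ) ^ 2 = 1 / (n * τ ^ 2) := by field_simp
      rw [this, mul_one_div, div_le_div_iff₀ (by positivity) two_pos]
      linarith
  linarith

omit [Fintype Y] in
theorem sum_prod_mul_exp_infoDensity {P : X → ℝ} (hP : IsPM P) {V : X → Y → ℝ}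
    (hV : ∀ a b, 0 < V a b) {n : ℕ} (y : Fin n → Y) :
    ∑ x : Fin n → X, (∏ i, P (x i)) * Real.exp (infoDensity P V x y) = 1 := by
  classical
  have hterm : ∀ x : Fin n → X, (∏ i, P (x i)) * Real.exp (infoDensity P V x y) =
      ∏ i, P (x i) * (V (x i) (y i) / outDist P V (y i)) := fun x => by
    rw [infoDensity, Real.exp_sum, Finset.prod_mul_distrib]
    exact congrArg _ (Finset.prod_congr rfl fun i _ =>
      Real.exp_log (div_pos (hV _ _) (outDist_pos hP hV _)))
  rw [Finset.sum_congr rfl fun x _ => hterm x,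
    ← Fintype.prod_sum (fun i a => P a * (V a (y i) / outDist P V (y i)))]
  refine Finset.prod_eq_one fun i _ => ?_
  simp only [← mul_div_assoc, ← Finset.sum_div]
  exact div_self (outDist_pos hP hV _).ne'

omit [Fintype Y] in
theorem sum_prod_le_exp_neg_of_lt_infoDensity {P : X → ℝ} (hP : IsPM P) {V : X → Y → ℝ}
    (hV : ∀ a b, 0 < V a b) {n : ℕ} {u : ℝ} (S : Finset (Fin n → X)) (y : Fin n → Y)
    (hS : ∀ x ∈ S, u < infoDensity P V x y) :
    ∑ x ∈ S, ∏ i, P (x i) ≤ Real.exp (-u) := by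
  have hw : ∀ x : Fin n → X, 0 ≤ ∏ i, P (x i) := fun x => Finset.prod_nonneg fun i _ => hP.1 _
  have h1 : ∀ x ∈ S, ∏ i, P (x i) ≤
      Real.exp (-u) * ((∏ i, P (x i)) * Real.exp (infoDensity P V x y)) := fun x hx => by
    rw [mul_left_comm, ← Real.exp_add]
    exact le_mul_of_one_le_right (hw x) (Real.one_le_exp (by linarith [hS x hx]))
  refine (Finset.sum_le_sum h1).trans ?_
  rw [← Finset.mul_sum]
  refine mul_le_of_le_one_right (Real.exp_pos _).le ?_
  rw [← sum_prod_mul_exp_infoDensity hP hV y]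
  exact Finset.sum_le_sum_of_subset_of_nonneg (Finset.subset_univ S) fun x _ _ =>
    mul_nonneg (hw x) (Real.exp_pos _).le

/-- For a fixed output, a random input passes the threshold test with small probability. -/
theorem sum_thresholdSet_le {P : X → ℝ} (hP : IsPM P) {F : Finset (X → Y → ℝ)}
    (hF : ∀ V ∈ F, ∀ a b, 0 < V a b) {n : ℕ} (r : ℝ) (S : Finset (Fin n → X)) (y : Fin n → Y)
    (hS : ∀ x ∈ S, y ∈ thresholdSet P F r x) :
    ∑ x ∈ S, ∏ i, P (x i) ≤ F.card * Real.exp (-(n * r)) := by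
  classical
  have hw : ∀ x : Fin n → X, 0 ≤ ∏ i, P (x i) := fun x => Finset.prod_nonneg fun i _ => hP.1 _
  refine (sum_le_sum_sum_of_forall_exists_mem S F
    (fun V => Finset.univ.filter fun x => n * r < infoDensity P V x y) _ hw fun x hx => ?_).trans ?_
  · obtain ⟨V, hV, h⟩ := (Finset.mem_filter.1 (hS x hx)).2
    exact ⟨V, hV, Finset.mem_filter.2 ⟨Finset.mem_univ _, h⟩⟩
  · exact (Finset.sum_le_card_nsmul F _ (Real.exp (-(n * r))) fun V hV =>
      sum_prod_le_exp_neg_of_lt_infoDensity hP (hF V hV) _ y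
        fun x hx => (Finset.mem_filter.1 hx).2).trans_eq (nsmul_eq_mul _ _)

/-- The average probability that a random input captures the output of another codeword. -/
theorem sum_mul_sum_Wn_thresholdSet_le {P : X → ℝ} (hP : IsPM P) {F : Finset (X → Y → ℝ)}
    (hF : ∀ V ∈ F, IsChannel V ∧ ∀ a b, 0 < V a b) {n : ℕ} (r : ℝ) (T : Finset (Fin n → X))
    (x' : Fin n → X) :
    ∑ x ∈ T, (∏ i, P (x i)) * ∑ V ∈ F, Wn (fun V => V) n V x' (thresholdSet P F r x) ≤
      F.card ^ 2 * Real.exp (-(n * r)) := by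
  classical
  have hswap : ∑ x ∈ T, (∏ i, P (x i)) * ∑ V ∈ F, Wn (fun V => V) n V x' (thresholdSet P F r x) =
      ∑ V ∈ F, ∑ y : Fin n → Y, (∏ i, V (x' i) (y i)) *
        ∑ x ∈ T.filter (fun x => y ∈ thresholdSet P F r x), ∏ i, P (x i) := by
    simp only [Finset.mul_sum]
    rw [Finset.sum_comm]
    refine Finset.sum_congr rfl fun V _ => ?_
    simp only [Wn, Finset.mul_sum]
    rw [Finset.sum_comm' (t' := Finset.univ)
      (s' := fun y => T.filter (fun x => y ∈ thresholdSet P F r x)) (by simp)]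
    exact Finset.sum_congr rfl fun y _ => Finset.sum_congr rfl fun x _ => mul_comm _ _
  rw [hswap, sq, mul_assoc, ← nsmul_eq_mul]
  refine Finset.sum_le_card_nsmul _ _ _ fun V hV => ?_
  calc _ ≤ ∑ y : Fin n → Y, (∏ i, V (x' i) (y i)) * (F.card * Real.exp (-(n * r))) :=
        Finset.sum_le_sum fun y _ => mul_le_mul_of_nonneg_left
          (sum_thresholdSet_le hP (fun V hV => (hF V hV).2) r _ y
            fun x hx => (Finset.mem_filter.1 hx).2)
          (Finset.prod_nonneg fun i _ => (hF V hV).1.1 _ _)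
    _ = _ := by
        rw [← Finset.sum_mul, sum_prod_eq_one n (fun i => V (x' i)) fun i => (hF V hV).1.2 _,
          one_mul]

/-- A typical codeword fails the threshold test with small probability. -/
theorem Wn_compl_thresholdSet_le [DecidableEq X] [DecidableEq Y] {P : X → ℝ} (hP : IsPM P)
    {F : Finset (X → Y → ℝ)}
    {W V : X → Y → ℝ} (hW : IsChannel W) (hVF : V ∈ F) (hV : IsChannel V)
    (hVpos : ∀ a b, 0 < V a b) {η : ℝ} (hWV : ∀ a b, W a b ≤ Real.exp η * V a b) {B : ℝ}
    (hB : ∀ a b, |Real.log (V a b / outDist P V b)| ≤ B) {n : ℕ} (hn : 0 < n)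
    {τ r s : ℝ} (hs : 0 < s) (hr : r + s ≤ mutInfo P W - η - Fintype.card X * (τ * B))
    {x : Fin n → X} (hx : x ∈ nearType P n τ) :
    Wn (fun V => V) n W x (thresholdSet P F r x)ᶜ ≤ n * B ^ 2 / (n * s) ^ 2 := by
  have hn' : (0 : ℝ) < n := by positivity
  set φ : X → ℝ := fun a => ∑ b, W a b * Real.log (V a b / outDist P V b) with hφ
  have hφB : ∀ a, |φ a| ≤ B := fun a => by
    calc |φ a| ≤ ∑ b, |W a b * Real.log (V a b / outDist P V b)| := Finset.abs_sum_le_sum_abs _ _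
      _ ≤ ∑ b, W a b * B := Finset.sum_le_sum fun b _ => by
          rw [abs_mul, abs_of_nonneg (hW.1 a b)]
          exact mul_le_mul_of_nonneg_left (hB a b) (hW.1 a b)
      _ = B := by rw [← Finset.sum_mul, hW.2, one_mul]
  have hmean : mutInfo P W - η - Fintype.card X * (τ * B) ≤ ∑ a, emp n x a * φ a := by
    have h1 : mutInfo P W - η ≤ ∑ a, P a * φ a :=
      mutInfo_sub_le_of_le_exp_mul hP hW hV hVpos hWV
    have h2 : ∀ a, P a * φ a - τ * B ≤ emp n x a * φ a := fun a => by
      have hτ : |emp n x a - P a| ≤ τ := (Finset.mem_filter.1 hx).2 a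
      have h3 : |(emp n x a - P a) * φ a| ≤ τ * B := by
        rw [abs_mul]
        exact mul_le_mul hτ (hφB a) (abs_nonneg _) ((abs_nonneg _).trans hτ)
      linarith [neg_abs_le ((emp n x a - P a) * φ a)]
    have h4 := Finset.sum_le_sum fun a (_ : a ∈ Finset.univ) => h2 a
    rw [Finset.sum_sub_distrib, Finset.sum_const, Finset.card_univ, nsmul_eq_mul] at h4
    linarith
  refine sum_prod_deviation_le n (fun i => W (x i))
    (fun i b => Real.log (V (x i) b / outDist P V b)) (fun i => hW.1 _) (fun i => hW.2 _)
    (fun i => hB _) (mul_pos hn' hs) _ fun y hy => ?_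
  have hy' : infoDensity P V x y ≤ n * r := by
    by_contra! hcon
    exact Finset.mem_compl.1 hy (Finset.mem_filter.2 ⟨Finset.mem_univ _, V, hVF, hcon⟩)
  have hsum : ∑ i, ∑ b, W (x i) b * Real.log (V (x i) b / outDist P V b) =
      n * ∑ a, emp n x a * φ a := sum_comp_eq_sum_emp hn x φ
  rw [hsum, abs_sub_comm]
  refine le_trans ?_ (le_abs_self _)
  have := mul_le_mul_of_nonneg_left (hr.trans hmean) hn'.le
  rw [mul_add] at this
  change _ ≤ _ - infoDensity P V x y
  linarith

omit [Fintype X] in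
theorem Wn_le_exp_mul {W V : X → Y → ℝ} (hW : IsChannel W) {η : ℝ}
    (hWV : ∀ a b, W a b ≤ Real.exp η * V a b) {n : ℕ} (x : Fin n → X)
    (S : Finset (Fin n → Y)) :
    Wn (fun V => V) n W x S ≤ Real.exp (n * η) * Wn (fun V => V) n V x S := by
  rw [Wn, Wn, Finset.mul_sum]
  refine Finset.sum_le_sum fun y _ => ?_
  refine (Finset.prod_le_prod (fun i _ => hW.1 _ _) fun i _ => hWV _ _).trans_eq ?_
  rw [Finset.prod_mul_distrib, Finset.prod_const, Finset.card_univ, Fintype.card_fin,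
    ← Real.exp_nat_mul]

/-- Coding theorem for the compound channel of all `W` with `I(P, W) ≥ A`. -/
theorem exists_compound_code [Nonempty X] [Nonempty Y] [DecidableEq X] [DecidableEq Y]
    {P : X → ℝ} (hP : IsPM P) (A : ℝ) {δ ε : ℝ} (hδ : 0 < δ) (hε : 0 < ε) :
    ∃ n₀ : ℕ, ∀ n : ℕ, n₀ ≤ n →
      ∃ (M : ℕ) (c : Fin M → Fin n → X) (D : Fin M → Finset (Fin n → Y)),
        0 < M ∧ (∀ m m', m ≠ m' → Disjoint (D m) (D m')) ∧
        A - δ ≤ (n : ℝ)⁻¹ * Real.log M ∧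
        ∀ W : X → Y → ℝ, IsChannel W → A ≤ mutInfo P W →
          ∀ m, Wn (fun V => V) n W (c m) (D m)ᶜ ≤ ε := by
  classical
  rcases le_or_gt (A - δ) 0 with hA | hA
  · exact ⟨0, fun n _ => ⟨1, fun _ _ => Classical.arbitrary X, fun _ => Finset.univ, one_pos,
      fun m m' h => (h (Subsingleton.elim _ _)).elim, by simpa using hA,
      fun W _ _ m => by simpa [Wn] using hε.le⟩⟩
  obtain ⟨F, hF, hFdom⟩ := exists_finite_dominating_channels X Y (η := δ / 8) (by positivity)
  obtain ⟨B, hB1, hB⟩ : ∃ B : ℝ, 1 ≤ B ∧ ∀ V ∈ F, ∀ a b,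
      |Real.log (V a b / outDist P V b)| ≤ B := by
    obtain ⟨B, hB⟩ := ((F ×ˢ (Finset.univ : Finset (X × Y))).image fun z =>
      |Real.log (z.1 z.2.1 z.2.2 / outDist P z.1 z.2.2)|).exists_le
    exact ⟨max B 1, le_max_right _ _, fun V hV a b => (hB _ (Finset.mem_image.2
      ⟨(V, a, b), by simpa using hV, rfl⟩)).trans (le_max_left _ _)⟩
  have hX : (0 : ℝ) < Fintype.card X := by exact_mod_cast Fintype.card_pos
  set τ : ℝ := δ / (8 * Fintype.card X * B) with hτ
  have hτ0 : 0 < τ := by positivity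
  have hτB : Fintype.card X * (τ * B) = δ / 8 := by rw [hτ]; field_simp
  set L : ℝ := F.card + 1 with hL
  have hL0 : 0 < L := by positivity
  have hlarge : ∀ K k : ℝ, 0 < k → ∀ᶠ n : ℕ in Filter.atTop, K ≤ n * k := fun K k hk =>
    (tendsto_natCast_atTop_atTop.atTop_mul_const hk).eventually_ge_atTop K
  obtain ⟨n₀, hn₀⟩ := Filter.eventually_atTop.1 ((Filter.eventually_gt_atTop 0).and
    ((hlarge (2 * Fintype.card X) (τ ^ 2) (by positivity)).and
      ((hlarge (32 * B ^ 2) (δ ^ 2 * ε) (by positivity)).and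
        (hlarge (16 * L ^ 2) (3 * δ / 8 * (ε / 2)) (by positivity)))))
  refine ⟨n₀, fun n hn => ?_⟩
  obtain ⟨hn0, hn1, hn2, hn3⟩ := hn₀ n hn
  have hnR : (0 : ℝ) < n := by positivity
  set r : ℝ := A - δ / 2 with hr
  set M : ℕ := ⌈Real.exp (n * (A - δ))⌉₊ with hM
  have hM0 : 0 < M := Nat.ceil_pos.2 (Real.exp_pos _)
  have hMge : Real.exp (n * (A - δ)) ≤ M := Nat.le_ceil _
  have hMle : (M : ℝ) ≤ 2 * Real.exp (n * (A - δ)) := by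
    have h1 := Nat.ceil_lt_add_one (Real.exp_pos (n * (A - δ))).le
    have h2 : 1 ≤ Real.exp (n * (A - δ)) := Real.one_le_exp (by positivity)
    linarith
  set k : ℝ := 2 * L ^ 2 * Real.exp (-(n * r)) with hk
  have hk0 : 0 < k := by positivity
  set T := nearType P n τ with hT
  have hThalf : 1 / 2 ≤ ∑ x ∈ T, ∏ i, P (x i) := half_le_sum_nearType hP hn0 hτ0 hn1
  have hWn0 : ∀ V : X → Y → ℝ, IsChannel V → ∀ (x : Fin n → X) S,
      0 ≤ Wn (fun V => V) n V x S := fun V hV x S =>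
    Finset.sum_nonneg fun y _ => Finset.prod_nonneg fun i _ => hV.1 _ _
  have hcost : ∀ x', ∑ x ∈ T, (∏ i, P (x i)) *
      ∑ V ∈ F, Wn (fun V => V) n V x' (thresholdSet P F r x) ≤ k * ∑ x ∈ T, ∏ i, P (x i) := by
    intro x'
    refine (sum_mul_sum_Wn_thresholdSet_le hP hF r T x').trans ?_
    have h1 : (F.card : ℝ) ^ 2 ≤ L ^ 2 := pow_le_pow_left₀ (by positivity) (by simp [hL]) 2
    calc _ ≤ L ^ 2 * Real.exp (-(n * r)) := mul_le_mul_of_nonneg_right h1 (Real.exp_pos _).le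
      _ = k * (1 / 2) := by rw [hk]; ring
      _ ≤ _ := mul_le_mul_of_nonneg_left hThalf hk0.le
  obtain ⟨x, hxT, hxcost⟩ := exists_expurgated_family T (fun x => ∏ i, P (x i))
    (fun x => Finset.prod_nonneg fun i _ => hP.1 _) (by linarith)
    (fun x' x => ∑ V ∈ F, Wn (fun V => V) n V x' (thresholdSet P F r x))
    (fun x' x => Finset.sum_nonneg fun V hV => hWn0 V (hF V hV).1 _ _) hk0 hcost hM0
  have hinterference : Real.exp (n * (δ / 8)) * (4 * M * k) ≤ ε / 2 := by
    have h1 : Real.exp (n * (δ / 8)) * (4 * M * k) ≤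
        16 * L ^ 2 * Real.exp (-(n * (3 * δ / 8))) := by
      have hexp : Real.exp (n * (δ / 8)) * Real.exp (n * (A - δ)) * Real.exp (-(n * r)) =
          Real.exp (-(n * (3 * δ / 8))) := by
        rw [← Real.exp_add, ← Real.exp_add, hr]
        congr 1
        ring
      calc _ ≤ Real.exp (n * (δ / 8)) * (4 * (2 * Real.exp (n * (A - δ))) * k) := by gcongr
        _ = _ := by rw [hk, ← hexp]; ring
    refine h1.trans ?_
    rw [Real.exp_neg, ← div_eq_mul_inv, div_le_iff₀ (Real.exp_pos _)]
    have h2 := Real.add_one_le_exp (n * (3 * δ / 8))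
    nlinarith
  have hmiss : n * B ^ 2 / (n * (δ / 4)) ^ 2 ≤ ε / 2 := by
    rw [div_le_iff₀ (by positivity)]
    nlinarith
  refine ⟨M, x, fun m => thresholdSet P F r (x m) \
    (Finset.univ.filter fun m' => m < m').biUnion fun m' => thresholdSet P F r (x m'), hM0, ?_,
    ?_, ?_⟩
  · have hlt : ∀ m m' : Fin M, m < m' → Disjoint
        (thresholdSet P F r (x m) \
          (Finset.univ.filter fun m' => m < m').biUnion fun m' => thresholdSet P F r (x m'))
        (thresholdSet P F r (x m') \
          (Finset.univ.filter fun m'' => m' < m'').biUnion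
            fun m' => thresholdSet P F r (x m')) := by
      intro m m' h
      refine Finset.disjoint_left.2 fun y hy hy' => (Finset.mem_sdiff.1 hy).2 ?_
      exact Finset.mem_biUnion.2 ⟨m', by simpa using h, (Finset.mem_sdiff.1 hy').1⟩
    intro m m' h
    rcases lt_or_gt_of_ne h with h | h
    · exact hlt m m' h
    · exact (hlt m' m h).symm
  · rw [le_inv_mul_iff₀ hnR, ← Real.log_exp (n * (A - δ))]
    exact Real.log_le_log (Real.exp_pos _) hMge
  · intro W hW hWA m
    obtain ⟨V, hVF, hWV⟩ := hFdom W hW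
    have h1 : Wn (fun V => V) n W (x m) (thresholdSet P F r (x m))ᶜ ≤ ε / 2 :=
      (Wn_compl_thresholdSet_le hP hW hVF (hF V hVF).1 (hF V hVF).2 hWV
        (hB V hVF) hn0 (by positivity) (by rw [hτB]; linarith) (hxT m)).trans hmiss
    have h2 : ∑ m' ∈ Finset.univ.filter (fun m' => m < m'),
        Wn (fun V => V) n W (x m) (thresholdSet P F r (x m')) ≤ ε / 2 := by
      refine le_trans ?_ ((mul_le_mul_of_nonneg_left (hxcost m) (Real.exp_pos _).le).trans
        hinterference)
      rw [Finset.mul_sum]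
      refine Finset.sum_le_sum fun m' _ => (Wn_le_exp_mul hW hWV _ _).trans
        (mul_le_mul_of_nonneg_left ?_ (Real.exp_pos _).le)
      exact Finset.single_le_sum
        (f := fun V => Wn (fun V => V) n V (x m) (thresholdSet P F r (x m')))
        (fun V hV => hWn0 V (hF V hV).1 _ _) hVF
    have hw : ∀ y : Fin n → Y, 0 ≤ ∏ i, W (x m i) (y i) := fun y =>
      Finset.prod_nonneg fun i _ => hW.1 _ _
    refine le_trans (sum_le_sum_sum_of_forall_exists_mem _ Finset.univ
      (fun o : Option {m' // m < m'} => o.elim (thresholdSet P F r (x m))ᶜ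
        fun m' => thresholdSet P F r (x m')) _ hw fun y hy => ?_) ?_
    · by_cases hy' : y ∈ thresholdSet P F r (x m)
      · have hmem : ∃ m', m < m' ∧ y ∈ thresholdSet P F r (x m') := by
          simpa [hy'] using hy
        obtain ⟨m', hm', hym'⟩ := hmem
        exact ⟨some ⟨m', hm'⟩, Finset.mem_univ _, hym'⟩
      · exact ⟨none, Finset.mem_univ _, Finset.mem_compl.2 hy'⟩
    · rw [Fintype.sum_option]
      rw [Finset.sum_subtype (p := fun m' => m < m') _ (by simp)] at h2
      exact (add_le_add h1 h2).trans_eq (add_halves ε)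

end Coding

theorem outage_corollary_achievability
    (X Y Θ : Type) [Fintype X] [Fintype Y] [Nonempty X] [Nonempty Y]
    [DecidableEq X] [DecidableEq Y] [MeasurableSpace Θ]
    (μ : MeasureTheory.Measure Θ) [MeasureTheory.IsProbabilityMeasure μ]
    (W : Θ → X → Y → ℝ) (hW : ∀ θ, IsChannel (W θ))
    (hWmeas : ∀ x y, Measurable fun θ => W θ x y)
    (ε γ δ : ℝ) (hε0 : 0 < ε) (hε1 : ε < 1) (hγ0 : 0 < γ) (hγ1 : γ < 1)
    (hδ0 : 0 < δ) (hδ1 : δ < 1)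
    (P : X → ℝ) (hP : IsPM P) :
    ∃ n₀ : ℕ, ∀ n : ℕ, n₀ ≤ n →
      ∀ R : ℝ, 0 ≤ R → R ≤ ratesFormula μ W γ P →
      ∃ (M : ℕ) (c : Fin M → Fin n → X) (D : Fin M → Finset (Fin n → Y)),
        0 < M ∧
        (∀ m m', m ≠ m' → Disjoint (D m) (D m')) ∧
        ENNReal.ofReal (1 - γ) ≤ μ (lambdaSet W c D ε) ∧
        R - 2 * δ ≤ (n : ℝ)⁻¹ * Real.log M := by
  obtain ⟨r, ⟨Λ, -, hΛ, rfl⟩, hr⟩ := exists_lt_of_lt_csSup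
    (s := {r : ℝ | ∃ Λ : Set Θ, MeasurableSet Λ ∧ ENNReal.ofReal (1 - γ) ≤ μ Λ ∧
      r = sInf ((fun θ => mutInfo P (W θ)) '' Λ)})
    ⟨_, Set.univ, MeasurableSet.univ, by simp [hγ0.le], rfl⟩
    (sub_lt_self (ratesFormula μ W γ P) hδ0)
  obtain ⟨n₀, hn₀⟩ := exists_compound_code (Y := Y) hP (ratesFormula μ W γ P - δ) hδ0 hε0
  refine ⟨n₀, fun n hn R _ hR => ?_⟩
  obtain ⟨M, c, D, hM, hD, hrate, herr⟩ := hn₀ n hn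
  refine ⟨M, c, D, hM, hD, hΛ.trans (MeasureTheory.measure_mono fun θ hθ m => ?_), by linarith⟩
  refine herr (W θ) (hW θ) (hr.le.trans (csInf_le ⟨0, ?_⟩ ⟨θ, hθ, rfl⟩)) m
  rintro _ ⟨θ', -, rfl⟩
  exact mutInfo_nonneg hP (hW θ')
end

section
/- (Upper bound on the union of decoding sets contained in robust typical sets.) Let P be a probability mass function on 𝒳, let Λ ⊆ Θ, let δ > 0, and let (δ_n) be a δ-sequence (δ_n → 0 and √n·δ_n → ∞). Assume 𝒲_Λ is a relatively τ₀-open subset of 𝒲_Λ ∪ 𝒫_n(𝒴|𝒳) for all n. Then for all sufficiently large n the following holds: for every length-n code with codewords x₁,…,x_M ∈ T_Pⁿ(δ_n) and pairwise disjoint decoding sets 𝒟₁,…,𝒟_M satisfying 𝒟_m ⊆ B_Λⁿ(x_m, δ_n) for each m, the union satisfies |∪_{m=1}^M 𝒟_m| ≤ M · exp[n(H(𝒲_Λ|P) + δ)]. -/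
open scoped BigOperators
open Finset

open Filter Topology

section Continuity

/-- A continuous `f : [0,1] → [0,1]` has increments controlled by the squared Hellinger
increment, up to an arbitrarily small additive error. -/
theorem exists_sub_le_add_mul_sqrt_sub_sqrt_sq {f : ℝ → ℝ} (hf : Continuous f)
    (h01 : ∀ u, 0 ≤ u → u ≤ 1 → 0 ≤ f u ∧ f u ≤ 1) {ε : ℝ} (hε : 0 < ε) :
    ∃ K : ℝ, 0 < K ∧ ∀ u v : ℝ, 0 ≤ u → u ≤ 1 → 0 ≤ v → v ≤ 1 →
      f u - f v ≤ ε + K * (√u - √v) ^ 2 := by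
  have huc : UniformContinuousOn (fun s : ℝ => f (s ^ 2)) (Set.Icc 0 1) :=
    isCompact_Icc.uniformContinuousOn_of_continuous (by fun_prop)
  obtain ⟨η, hη, h⟩ := Metric.uniformContinuousOn_iff.1 huc ε hε
  refine ⟨1 / η ^ 2, by positivity, fun u v hu0 hu1 hv0 hv1 => ?_⟩
  have hsq : 0 ≤ 1 / η ^ 2 * (√u - √v) ^ 2 := by positivity
  by_cases hd : dist (√u) (√v) < η
  · have := h (√u) ⟨Real.sqrt_nonneg _, Real.sqrt_le_one.2 hu1⟩ (√v)
      ⟨Real.sqrt_nonneg _, Real.sqrt_le_one.2 hv1⟩ hd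
    simp only [Real.sq_sqrt hu0, Real.sq_sqrt hv0, Real.dist_eq] at this
    linarith [le_abs_self (f u - f v)]
  · have h1 : η ^ 2 ≤ (√u - √v) ^ 2 := by
      rw [← sq_abs (√u - √v)]
      exact pow_le_pow_left₀ hη.le (by simpa [Real.dist_eq] using hd) 2
    have h2 : 1 ≤ 1 / η ^ 2 * (√u - √v) ^ 2 := by
      rw [one_div, inv_mul_eq_div]
      exact (one_le_div (by positivity)).2 h1
    linarith [(h01 u hu0 hu1).2, (h01 v hv0 hv1).1]

theorem negMulLog_mem_unit {u : ℝ} (h0 : 0 ≤ u) (h1 : u ≤ 1) :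
    0 ≤ Real.negMulLog u ∧ Real.negMulLog u ≤ 1 := by
  refine ⟨Real.negMulLog_nonneg h0 h1, ?_⟩
  rcases h0.eq_or_lt with rfl | hu
  · simp
  · have h := mul_le_mul_of_nonneg_left (Real.one_sub_inv_le_log_of_pos hu) h0
    rw [mul_sub, mul_inv_cancel₀ hu.ne'] at h
    rw [Real.negMulLog]
    linarith

variable {ι X Y : Type} [Fintype ι] [Fintype Y]

theorem IsChannel.isPM {V : X → Y → ℝ} (hV : IsChannel V) (a : X) : IsPM (V a) :=
  ⟨hV.1 a, hV.2 a⟩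

theorem IsPM.le_one {p : ι → ℝ} (hp : IsPM p) (a : ι) : p a ≤ 1 :=
  hp.2 ▸ Finset.single_le_sum (fun b _ => hp.1 b) (Finset.mem_univ a)

/-- The squared Hellinger distance is bounded by the Kullback–Leibler divergence. -/
theorem sum_sqrt_sub_sqrt_sq_le_klDiv {q p : ι → ℝ} (hq : IsPM q) (hp : IsPM p)
    (hac : absCont q p) : ∑ a, (√(q a) - √(p a)) ^ 2 ≤ klDiv q p := by
  have key : ∀ a, (√(q a) - √(p a)) ^ 2 + q a - p a ≤ q a * Real.log (q a / p a) := by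
    intro a
    have e : (√(q a) - √(p a)) ^ 2 = q a - 2 * (√(q a) * √(p a)) + p a := by
      rw [sub_sq, Real.sq_sqrt (hq.1 a), Real.sq_sqrt (hp.1 a)]
      ring
    rcases (hq.1 a).eq_or_lt with h0 | h0
    · rw [e, ← h0]
      simp
    · have hpa : 0 < p a := (hp.1 a).lt_of_ne' (hac a h0.ne')
      have hsq := Real.sqrt_pos.2 h0
      have hsp := Real.sqrt_pos.2 hpa
      have hlog : Real.log (q a / p a) = 2 * Real.log (√(q a) / √(p a)) := by
        rw [← Real.sqrt_div h0.le, Real.log_sqrt (by positivity)]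
        ring
      have hl := Real.one_sub_inv_le_log_of_pos (div_pos hsq hsp)
      have hm := mul_le_mul_of_nonneg_left hl h0.le
      have hr : q a * (1 - (√(q a) / √(p a))⁻¹) = q a - √(q a) * √(p a) := by
        have := Real.mul_self_sqrt h0.le
        rw [inv_div]
        field_simp
        linear_combination √(p a) * this
      rw [e, hlog]
      linarith
  have h := Finset.sum_le_sum fun a (_ : a ∈ Finset.univ) => key a
  rw [Finset.sum_sub_distrib, Finset.sum_add_distrib, hq.2, hp.2] at h
  rw [klDiv]
  linarith

variable [Fintype X]

theorem condEnt_eq_sum_negMulLog (P : X → ℝ) (V : X → Y → ℝ) :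
    condEnt P V = ∑ a, P a * ∑ b, Real.negMulLog (V a b) := by
  simp [condEnt, Real.negMulLog, Finset.sum_neg_distrib]

/-- The entropy of an output distribution is crudely bounded by the alphabet size. -/
theorem IsPM.sum_negMulLog_mem {p : ι → ℝ} (hp : IsPM p) :
    0 ≤ ∑ b, Real.negMulLog (p b) ∧ ∑ b, Real.negMulLog (p b) ≤ Fintype.card ι := by
  refine ⟨Finset.sum_nonneg fun b _ => (negMulLog_mem_unit (hp.1 b) (hp.le_one b)).1, ?_⟩
  refine (Finset.sum_le_sum fun b _ => (negMulLog_mem_unit (hp.1 b) (hp.le_one b)).2).trans ?_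
  simp

theorem condEnt_le_card {P : X → ℝ} (hP : IsPM P) {V : X → Y → ℝ} (hV : IsChannel V) :
    condEnt P V ≤ Fintype.card Y := by
  rw [condEnt_eq_sum_negMulLog]
  calc _ ≤ ∑ a, P a * (Fintype.card Y : ℝ) := Finset.sum_le_sum fun a _ =>
        mul_le_mul_of_nonneg_left (hV.isPM a).sum_negMulLog_mem.2 (hP.1 a)
    _ = Fintype.card Y := by rw [← Finset.sum_mul, hP.2, one_mul]

/-- Channels that are close in conditional divergence have close conditional entropies,
uniformly in the input distribution. -/
theorem exists_condEnt_le_of_condKL_le (X Y : Type) [Fintype X] [Fintype Y] [Nonempty Y]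
    {δ : ℝ} (hδ : 0 < δ) :
    ∃ η : ℝ, 0 < η ∧ ∀ (Q : X → ℝ) (V W : X → Y → ℝ), IsPM Q →
      (∀ a, Q a ≠ 0 → IsPM (V a)) → IsChannel W → condAbsCont Q V W →
      condKL Q V W ≤ η → condEnt Q V ≤ condEnt Q W + δ := by
  have hY : (0 : ℝ) < Fintype.card Y := by exact_mod_cast Fintype.card_pos
  obtain ⟨K, hK, h⟩ := exists_sub_le_add_mul_sqrt_sub_sqrt_sq Real.continuous_negMulLog
    (fun u => negMulLog_mem_unit) (ε := δ / (2 * Fintype.card Y)) (by positivity)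
  refine ⟨δ / (2 * K), by positivity, fun Q V W hQ hV hW hac hKL => ?_⟩
  have key : ∀ a, Q a * ∑ b, Real.negMulLog (V a b) ≤ Q a * ∑ b, Real.negMulLog (W a b) +
      (Q a * (δ / 2) + K * (Q a * ∑ b, V a b * Real.log (V a b / W a b))) := by
    intro a
    by_cases hQa : Q a = 0
    · simp [hQa]
    have hWa := hW.isPM a
    have hVa := hV a hQa
    have h1 := sum_sqrt_sub_sqrt_sq_le_klDiv hVa hWa fun b => hac a b hQa
    have h2 : ∑ b, (Real.negMulLog (V a b) - Real.negMulLog (W a b)) ≤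
        ∑ b, (δ / (2 * Fintype.card Y) + K * (√(V a b) - √(W a b)) ^ 2) :=
      Finset.sum_le_sum fun b _ =>
        h _ _ (hVa.1 b) (hVa.le_one b) (hWa.1 b) (hWa.le_one b)
    rw [Finset.sum_sub_distrib, Finset.sum_add_distrib, ← Finset.mul_sum, Finset.sum_const,
      nsmul_eq_mul, Finset.card_univ] at h2
    have h3 : (Fintype.card Y : ℝ) * (δ / (2 * Fintype.card Y)) = δ / 2 := by field_simp
    have h4 := mul_le_mul_of_nonneg_left h1 hK.le
    rw [klDiv] at h4
    have h5 : ∑ b, Real.negMulLog (V a b) ≤ ∑ b, Real.negMulLog (W a b) +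
        (δ / 2 + K * ∑ b, V a b * Real.log (V a b / W a b)) := by linarith
    have h6 := mul_le_mul_of_nonneg_left h5 (hQ.1 a)
    linarith
  have hs := Finset.sum_le_sum fun a (_ : a ∈ Finset.univ) => key a
  rw [Finset.sum_add_distrib, Finset.sum_add_distrib, ← Finset.sum_mul, hQ.2,
    ← Finset.mul_sum, ← condEnt_eq_sum_negMulLog, ← condEnt_eq_sum_negMulLog] at hs
  have h7 : K * condKL Q V W ≤ δ / 2 :=
    (mul_le_mul_of_nonneg_left hKL hK.le).trans_eq (by field_simp)
  rw [condKL] at h7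
  linarith

/-- Input distributions that are close in divergence yield close conditional entropies,
uniformly in the channel. -/
theorem exists_condEnt_le_of_klDiv_le (X Y : Type) [Fintype X] [Fintype Y] [Nonempty X]
    [Nonempty Y] {δ : ℝ} (hδ : 0 < δ) :
    ∃ η : ℝ, 0 < η ∧ ∀ (Q P : X → ℝ) (W : X → Y → ℝ), IsPM Q → IsPM P → IsChannel W →
      absCont Q P → klDiv Q P ≤ η → condEnt Q W ≤ condEnt P W + δ := by
  have hX : (0 : ℝ) < Fintype.card X := by exact_mod_cast Fintype.card_pos
  have hY : (0 : ℝ) < Fintype.card Y := by exact_mod_cast Fintype.card_pos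
  obtain ⟨K, hK, h⟩ := exists_sub_le_add_mul_sqrt_sub_sqrt_sq continuous_id
    (fun u h0 h1 => ⟨h0, h1⟩) (ε := δ / (2 * Fintype.card X * Fintype.card Y)) (by positivity)
  refine ⟨δ / (2 * K * Fintype.card Y), by positivity, fun Q P W hQ hP hW hac hKL => ?_⟩
  have h1 := sum_sqrt_sub_sqrt_sq_le_klDiv hQ hP hac
  have key : ∀ a, (Q a - P a) * ∑ b, Real.negMulLog (W a b) ≤
      (δ / (2 * Fintype.card X * Fintype.card Y) + K * (√(Q a) - √(P a)) ^ 2) *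
        Fintype.card Y := by
    intro a
    obtain ⟨hH0, hH1⟩ := (hW.isPM a).sum_negMulLog_mem
    have := h _ _ (hQ.1 a) (hQ.le_one a) (hP.1 a) (hP.le_one a)
    exact (mul_le_mul_of_nonneg_right this hH0).trans
      (mul_le_mul_of_nonneg_left hH1 (by positivity))
  have hs := Finset.sum_le_sum fun a (_ : a ∈ Finset.univ) => key a
  simp only [sub_mul] at hs
  rw [Finset.sum_sub_distrib, ← Finset.sum_mul, Finset.sum_add_distrib, ← Finset.mul_sum,
    Finset.sum_const, nsmul_eq_mul, Finset.card_univ, ← condEnt_eq_sum_negMulLog,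
    ← condEnt_eq_sum_negMulLog, add_mul] at hs
  have h3 : (Fintype.card X : ℝ) * (δ / (2 * Fintype.card X * Fintype.card Y)) *
      Fintype.card Y = δ / 2 := by field_simp
  have h4 : K * ∑ a, (√(Q a) - √(P a)) ^ 2 * Fintype.card Y ≤ δ / 2 := by
    rw [← Finset.sum_mul]
    calc _ ≤ K * (δ / (2 * K * Fintype.card Y) * Fintype.card Y) := by
          gcongr
          exact h1.trans hKL
      _ = δ / 2 := by field_simp
  rw [← Finset.sum_mul, ← mul_assoc] at h4
  linarith

end Continuity

section Types

variable {X Y : Type} [DecidableEq X] [DecidableEq Y] {n : ℕ}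

/-- The number of positions at which the pair `(a, b)` occurs in `(x, y)`. -/
def pairCount (x : Fin n → X) (y : Fin n → Y) (a : X) (b : Y) : ℕ :=
  (Finset.univ.filter fun i => x i = a ∧ y i = b).card

theorem empCond_congr {x : Fin n → X} {y z : Fin n → Y} (h : pairCount x y = pairCount x z) :
    empCond n x y = empCond n x z := by
  funext a b
  have := congrFun (congrFun h a) b
  simp only [pairCount] at this
  simp only [empCond, this]

theorem isPM_emp [Fintype X] (hn : n ≠ 0) (x : Fin n → X) : IsPM (emp n x) := by
  refine ⟨fun a => by unfold emp; positivity, ?_⟩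
  have h : ∑ a, (Finset.univ.filter fun i => x i = a).card = n := by
    rw [← Finset.card_eq_sum_card_fiberwise (by simp)]
    simp
  have hn' : (n : ℝ) ≠ 0 := by exact_mod_cast hn
  simp only [emp]
  rw [← Finset.sum_div, ← Nat.cast_sum, h, div_self hn']

variable [Fintype Y]

theorem sum_pairCount (x : Fin n → X) (y : Fin n → Y) (a : X) :
    ∑ b, pairCount x y a b = (Finset.univ.filter fun i => x i = a).card := by
  rw [Finset.card_eq_sum_card_fiberwise (f := y) (t := Finset.univ) (by simp)]
  simp [pairCount, Finset.filter_filter]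

theorem isPM_empCond (x : Fin n → X) (y : Fin n → Y) {a : X}
    (ha : (Finset.univ.filter fun i => x i = a).card ≠ 0) : IsPM (empCond n x y a) := by
  refine ⟨fun b => by unfold empCond; positivity, ?_⟩
  simp only [empCond]
  rw [← Finset.sum_div, ← Nat.cast_sum]
  have := sum_pairCount x y a
  simp only [pairCount] at this
  rw [this, div_self (by exact_mod_cast ha)]

theorem mul_emp_mul_empCond (hn : n ≠ 0) (x : Fin n → X) (y : Fin n → Y) (a : X) (b : Y) :
    (n : ℝ) * (emp n x a * empCond n x y a b) = pairCount x y a b := by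
  have hn' : (n : ℝ) ≠ 0 := by exact_mod_cast hn
  by_cases ha : (Finset.univ.filter fun i => x i = a).card = 0
  · have h : pairCount x y a b = 0 := by
      have := sum_pairCount x y a
      rw [ha, Finset.sum_eq_zero_iff] at this
      exact this b (Finset.mem_univ b)
    simp [emp, ha, h]
  · have ha' : ((Finset.univ.filter fun i => x i = a).card : ℝ) ≠ 0 := by exact_mod_cast ha
    rw [emp, empCond, pairCount]
    field_simp

variable [Fintype X]

theorem sum_eq_sum_pairCount_mul (x : Fin n → X) (y : Fin n → Y) (f : X → Y → ℝ) :
    ∑ i, f (x i) (y i) = ∑ a, ∑ b, (pairCount x y a b : ℝ) * f a b := by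
  rw [← Finset.sum_product' (f := fun a b => (pairCount x y a b : ℝ) * f a b),
    ← Finset.sum_fiberwise_of_maps_to (s := Finset.univ)
      (t := (Finset.univ : Finset X) ×ˢ (Finset.univ : Finset Y))
      (g := fun i => (x i, y i)) (by simp)]
  refine Finset.sum_congr rfl fun p _ => ?_
  rw [Finset.sum_congr rfl (g := fun _ => f p.1 p.2)]
  · simp [pairCount, Prod.ext_iff]
  · intro i hi
    rw [← (Finset.mem_filter.1 hi).2]

/-- Every element of a conditional type class has probability `exp (-n H)` under the
memoryless channel given by its empirical conditional distribution. -/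
theorem prod_empCond_eq_exp (hn : n ≠ 0) (x : Fin n → X) (y : Fin n → Y) :
    ∏ i, empCond n x y (x i) (y i) =
      Real.exp (-(n * condEnt (emp n x) (empCond n x y))) := by
  have hpos : ∀ i, 0 < empCond n x y (x i) (y i) := by
    intro i
    have h1 : 0 < (Finset.univ.filter fun j => x j = x i ∧ y j = y i).card :=
      Finset.card_pos.2 ⟨i, by simp⟩
    have h2 : 0 < (Finset.univ.filter fun j => x j = x i).card :=
      Finset.card_pos.2 ⟨i, by simp⟩
    unfold empCond
    positivity
  rw [Finset.prod_congr rfl fun i _ => (Real.exp_log (hpos i)).symm, ← Real.exp_sum,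
    sum_eq_sum_pairCount_mul x y fun a b => Real.log (empCond n x y a b), condEnt]
  congr 1
  rw [mul_neg, neg_neg, Finset.mul_sum]
  refine Finset.sum_congr rfl fun a _ => ?_
  rw [Finset.mul_sum, Finset.mul_sum]
  refine Finset.sum_congr rfl fun b _ => ?_
  rw [← mul_emp_mul_empCond hn]
  ring

/-- Size bound for conditional type classes. -/
theorem card_pairCount_fiber_le (hn : n ≠ 0) (x : Fin n → X) (y : Fin n → Y) :
    ((Finset.univ.filter fun z : Fin n → Y => pairCount x z = pairCount x y).card : ℝ) ≤
      Real.exp (n * condEnt (emp n x) (empCond n x y)) := by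
  set V := empCond n x y with hV
  have hVnn : ∀ a b, 0 ≤ V a b := fun a b => by rw [hV]; unfold empCond; positivity
  have htot : ∑ z : Fin n → Y, ∏ i, V (x i) (z i) = 1 := by
    have := Finset.prod_univ_sum (fun _ : Fin n => (Finset.univ : Finset Y))
      (fun i b => V (x i) b)
    rw [Fintype.piFinset_univ] at this
    rw [← this]
    refine Finset.prod_eq_one fun i _ => (isPM_empCond x y ?_).2
    exact (Finset.card_pos.2 ⟨i, by simp⟩).ne'
  have hsub : ∑ z ∈ Finset.univ.filter fun z : Fin n → Y => pairCount x z = pairCount x y,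
      ∏ i, V (x i) (z i) ≤ 1 :=
    htot ▸ Finset.sum_le_sum_of_subset_of_nonneg (Finset.subset_univ _)
      fun z _ _ => Finset.prod_nonneg fun i _ => hVnn _ _
  rw [Finset.sum_congr rfl (g := fun _ => Real.exp (-(n * condEnt (emp n x) V))),
    Finset.sum_const, nsmul_eq_mul, Real.exp_neg, ← div_eq_mul_inv,
    div_le_one (Real.exp_pos _)] at hsub
  · exact hsub
  · intro z hz
    have hz' : empCond n x z = V := empCond_congr (Finset.mem_filter.1 hz).2
    have := prod_empCond_eq_exp hn x z
    rwa [hz'] at this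

/-- There are at most `(n+1)^(|X||Y|)` joint types. -/
theorem card_image_pairCount_le (x : Fin n → X) (S : Finset (Fin n → Y)) :
    (S.image (pairCount x)).card ≤ (n + 1) ^ (Fintype.card X * Fintype.card Y) := by
  have hsub : S.image (pairCount x) ⊆ Fintype.piFinset fun _ : X =>
      Fintype.piFinset fun _ : Y => Finset.range (n + 1) := by
    intro t ht
    obtain ⟨y, -, rfl⟩ := Finset.mem_image.1 ht
    simp only [Fintype.mem_piFinset, Finset.mem_range, Nat.lt_succ_iff]
    intro a b
    exact (Finset.card_le_univ _).trans_eq (Fintype.card_fin n)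
  refine (Finset.card_le_card hsub).trans_eq ?_
  simp [← pow_mul, mul_comm]

theorem card_le_of_condEnt_le (hn : n ≠ 0) (x : Fin n → X) (S : Finset (Fin n → Y)) {h : ℝ}
    (hS : ∀ y ∈ S, condEnt (emp n x) (empCond n x y) ≤ h) :
    (S.card : ℝ) ≤ ((n : ℝ) + 1) ^ (Fintype.card X * Fintype.card Y) * Real.exp (n * h) := by
  rw [Finset.card_eq_sum_card_image (pairCount x) S, Nat.cast_sum]
  refine (Finset.sum_le_card_nsmul _ _ (Real.exp (n * h)) fun t ht => ?_).trans ?_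
  · obtain ⟨y, hy, rfl⟩ := Finset.mem_image.1 ht
    calc _ ≤ ((Finset.univ.filter fun z => pairCount x z = pairCount x y).card : ℝ) := by
          exact_mod_cast Finset.card_le_card (Finset.filter_subset_filter _ (Finset.subset_univ S))
      _ ≤ _ := card_pairCount_fiber_le hn x y
      _ ≤ _ := by
          gcongr
          exact hS y hy
  · rw [nsmul_eq_mul]
    gcongr
    exact_mod_cast card_image_pairCount_le x S

end Types

theorem eventually_succ_pow_le_exp (k : ℕ) {b : ℝ} (hb : 0 < b) :
    ∀ᶠ n : ℕ in atTop, ((n : ℝ) + 1) ^ k ≤ Real.exp (n * b) := by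
  have h := (isLittleO_pow_exp_pos_mul_atTop (k := k) hb).def (Real.exp_pos (-b))
  have ht : Tendsto (fun n : ℕ => (n : ℝ) + 1) atTop atTop :=
    tendsto_atTop_add_const_right _ _ tendsto_natCast_atTop_atTop
  filter_upwards [ht.eventually h] with n hn
  rw [Real.norm_of_nonneg (by positivity), Real.norm_of_nonneg (by positivity),
    ← Real.exp_add] at hn
  refine hn.trans_eq ?_
  congr 1
  ring

/-- All codeword-conditional robust typical sets are exponentially bounded. -/
theorem eventually_card_robustTyp_le
    {X Y Θ : Type} [Fintype X] [Fintype Y] [Nonempty X] [Nonempty Y]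
    [DecidableEq X] [DecidableEq Y]
    {W : Θ → X → Y → ℝ} (hW : ∀ θ, IsChannel (W θ)) {P : X → ℝ} (hP : IsPM P) (Λ : Set Θ)
    {δ : ℝ} (hδ : 0 < δ) {δseq : ℕ → ℝ} (hδseq : Tendsto δseq atTop (𝓝 0)) :
    ∀ᶠ n : ℕ in atTop, ∀ x ∈ typX P n (δseq n),
      ((robustTyp W n Λ x (δseq n)).card : ℝ) ≤ Real.exp (n * (entSup W Λ P + δ)) := by
  obtain ⟨η₁, hη₁, h₁⟩ := exists_condEnt_le_of_condKL_le X Y (δ := δ / 3) (by positivity)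
  obtain ⟨η₂, hη₂, h₂⟩ := exists_condEnt_le_of_klDiv_le X Y (δ := δ / 3) (by positivity)
  filter_upwards [eventually_ne_atTop 0, hδseq.eventually_le_const hη₁,
    hδseq.eventually_le_const hη₂,
    eventually_succ_pow_le_exp (Fintype.card X * Fintype.card Y) (b := δ / 3) (by positivity)]
    with n hn hn₁ hn₂ hpoly x hx
  have hx' : absCont (emp n x) P ∧ klDiv (emp n x) P ≤ δseq n := by simpa [typX] using hx
  have hbdd : BddAbove ((fun θ => condEnt P (W θ)) '' Λ) := by
    refine ⟨Fintype.card Y, ?_⟩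
    rintro _ ⟨θ, -, rfl⟩
    exact condEnt_le_card hP (hW θ)
  have hent : ∀ y ∈ robustTyp W n Λ x (δseq n),
      condEnt (emp n x) (empCond n x y) ≤ entSup W Λ P + δ / 3 + δ / 3 := by
    intro y hy
    obtain ⟨θ, hθ, hac, hKL⟩ : ∃ θ ∈ Λ, condAbsCont (emp n x) (empCond n x y) (W θ) ∧
        condKL (emp n x) (empCond n x y) (W θ) ≤ δseq n := by
      classical
      rw [robustTyp, Finset.mem_filter] at hy
      obtain ⟨-, θ, hθ, hyθ⟩ := hy
      rw [typY, Finset.mem_filter] at hyθ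
      exact ⟨θ, hθ, hyθ.2⟩
    have e₁ := h₁ _ _ _ (isPM_emp hn x)
      (fun a ha => isPM_empCond x y fun h0 => ha (by simp [emp, h0])) (hW θ) hac (hKL.trans hn₁)
    have e₂ := h₂ _ _ _ (isPM_emp hn x) hP (hW θ) hx'.1 (hx'.2.trans hn₂)
    have e₃ : condEnt P (W θ) ≤ entSup W Λ P := le_csSup hbdd ⟨θ, hθ, rfl⟩
    linarith
  calc _ ≤ _ := card_le_of_condEnt_le hn x _ hent
    _ ≤ Real.exp (n * (δ / 3)) * Real.exp (n * (entSup W Λ P + δ / 3 + δ / 3)) := by gcongr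
    _ = _ := by
      rw [← Real.exp_add]
      congr 1
      ring

theorem decoding_sets_union_bound
    (X Y Θ : Type) [Fintype X] [Fintype Y] [Nonempty X] [Nonempty Y]
    [DecidableEq X] [DecidableEq Y]
    (W : Θ → X → Y → ℝ) (hW : ∀ θ, IsChannel (W θ))
    (P : X → ℝ) (hP : IsPM P) (Λ : Set Θ) (δ : ℝ) (hδ : 0 < δ)
    (δseq : ℕ → ℝ) (hδseq : IsDeltaSeq δseq)
    (hopen : ∀ n : ℕ, relOpen ((fun θ => W θ) '' Λ) (empCondSet X Y n)) :
    ∃ N : ℕ, ∀ n : ℕ, N ≤ n →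
      ∀ (M : ℕ) (c : Fin M → Fin n → X) (D : Fin M → Finset (Fin n → Y)),
        (∀ m, c m ∈ typX P n (δseq n)) →
        (∀ m m', m ≠ m' → Disjoint (D m) (D m')) →
        (∀ m, D m ⊆ robustTyp W n Λ (c m) (δseq n)) →
        ((Finset.univ.biUnion D).card : ℝ) ≤
          (M : ℝ) * Real.exp ((n : ℝ) * (entSup W Λ P + δ)) := by
  obtain ⟨N, hN⟩ := eventually_atTop.1 (eventually_card_robustTyp_le hW hP Λ hδ hδseq.1)
  refine ⟨N, fun n hn M c D hc _ hD => ?_⟩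
  calc ((Finset.univ.biUnion D).card : ℝ) ≤ ∑ m, ((D m).card : ℝ) := by
        exact_mod_cast Finset.card_biUnion_le
    _ ≤ ∑ _m : Fin M, Real.exp (n * (entSup W Λ P + δ)) := Finset.sum_le_sum fun m _ =>
        (Nat.cast_le.2 (Finset.card_le_card (hD m))).trans (hN n hn (c m) (hc m))
    _ = M * Real.exp (n * (entSup W Λ P + δ)) := by simp
end
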